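/- arXiv:1607.04808 — 3 statements merged into one kernel-verified Lean document; each statement's English description precedes it below -/
import Mathlib

section
/- For every nonzero x in R^3 and all indices j, l in {1,2,3}, the stokeslet admits the operator representation (δ_{jl} Δ − ∂_j ∂_l) |x| = δ_{jl}/|x| + x_j x_l/|x|^3, where Δ is the Laplacian on R^3, ∂_j denotes the j-th partial derivative, and δ_{jl} is the Kronecker delta. -/
open MeasureTheory Real Filter

noncomputable section

/-- Euclidean 3-space. -/
abbrev E3 := EuclideanSpace ℝ (Fin 3)

/-- Partial derivative in the `j`-th coordinate direction. -/
def pd (j : Fin 3) (f : E3 → ℝ) (x : E3) : ℝ :=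
  fderiv ℝ f x (EuclideanSpace.single j 1)

/-- Laplacian on `E3`. -/
def lap (f : E3 → ℝ) (x : E3) : ℝ :=
  ∑ i : Fin 3, pd i (pd i f) x

/-- Gauss error function. -/
def erf (t : ℝ) : ℝ := (2 / Real.sqrt π) * ∫ s in (0:ℝ)..t, Real.exp (-s ^ 2)

/-- Complementary error function. -/
def erfc (t : ℝ) : ℝ := 1 - erf t

/-- Kronecker delta on `Fin 3`. -/
def kron (j l : Fin 3) : ℝ := if j = l then 1 else 0

/-- Levi-Civita symbol on `Fin 3`. -/
def lev (j l m : Fin 3) : ℝ :=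
  ((l.val : ℝ) - (j.val : ℝ)) * ((m.val : ℝ) - (l.val : ℝ)) * ((m.val : ℝ) - (j.val : ℝ)) / 2

/-- The Euclidean norm is differentiable away from the origin, with gradient `x / ‖x‖`. -/
lemma hasFDerivAt_norm_of_ne_zero {x : E3} (hx : x ≠ 0) :
    HasFDerivAt (fun y : E3 => ‖y‖) (‖x‖⁻¹ • innerSL ℝ x) x := by
  have h := (hasStrictFDerivAt_norm_sq x).hasFDerivAt.sqrt
    (pow_ne_zero 2 (norm_ne_zero_iff.mpr hx))
  simp only [Real.sqrt_sq (norm_nonneg _)] at h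
  rw [← Nat.cast_smul_eq_nsmul ℝ, smul_smul] at h
  have hc : 1 / (2 * ‖x‖) * ((2 : ℕ) : ℝ) = ‖x‖⁻¹ := by
    push_cast
    field_simp
  rwa [hc] at h

lemma pd_norm {x : E3} (hx : x ≠ 0) (l : Fin 3) :
    pd l (fun y => ‖y‖) x = x l * ‖x‖⁻¹ := by
  rw [pd, (hasFDerivAt_norm_of_ne_zero hx).fderiv]
  simp [EuclideanSpace.inner_single_right, mul_comm]

lemma pd_pd_norm {x : E3} (hx : x ≠ 0) (j l : Fin 3) :
    pd j (pd l (fun y => ‖y‖)) x = kron j l / ‖x‖ - x j * x l / ‖x‖ ^ 3 := by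
  have hr : ‖x‖ ≠ 0 := norm_ne_zero_iff.mpr hx
  have heq : pd l (fun y => ‖y‖) =ᶠ[nhds x] fun y => y l * ‖y‖⁻¹ := by
    filter_upwards [isOpen_ne.mem_nhds hx] with y hy using pd_norm hy l
  have hcoord : HasFDerivAt (fun y : E3 => y l) (EuclideanSpace.proj l : E3 →L[ℝ] ℝ) x :=
    (EuclideanSpace.proj l : E3 →L[ℝ] ℝ).hasFDerivAt
  have hinv : HasFDerivAt (fun y : E3 => ‖y‖⁻¹) (-(‖x‖ ^ 2)⁻¹ • ‖x‖⁻¹ • innerSL ℝ x) x :=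
    (hasDerivAt_inv hr).comp_hasFDerivAt x (hasFDerivAt_norm_of_ne_zero hx)
  rw [pd, heq.fderiv_eq, (hcoord.fun_mul hinv).fderiv]
  simp [EuclideanSpace.inner_single_right, kron, eq_comm (a := j)]
  split_ifs <;> field_simp <;> ring

/-- Operator representation of the stokeslet:
`(δ_{jl} Δ − ∂_j ∂_l) |x| = δ_{jl}/|x| + x_j x_l/|x|^3`. -/
theorem stokeslet_operator_form (x : E3) (hx : x ≠ 0) (j l : Fin 3) :
    kron j l * lap (fun y => ‖y‖) x - pd j (pd l (fun y => ‖y‖)) x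
      = kron j l / ‖x‖ + x j * x l / ‖x‖ ^ 3 := by
  have hr : ‖x‖ ≠ 0 := norm_ne_zero_iff.mpr hx
  have hsum : x 0 ^ 2 + x 1 ^ 2 + x 2 ^ 2 = ‖x‖ ^ 2 := by
    rw [EuclideanSpace.real_norm_sq_eq, Fin.sum_univ_three]
  have hlap : lap (fun y => ‖y‖) x = 2 / ‖x‖ := by
    simp only [lap, pd_pd_norm hx, Fin.sum_univ_three, kron, if_true]
    field_simp
    linear_combination -hsum
  rw [hlap, pd_pd_norm hx]
  ring
end
end

section
/- For every ξ > 0 and every nonzero x in R^3, the Ewald splitting function Φ_E(r, ξ) = r erf(ξ r) + erf(ξ r)/(2 ξ^2 r) + e^{-ξ^2 r^2}/(√π ξ), evaluated at r = |x|, satisfies the biharmonic relation Δ^2 [Φ_E(|x|, ξ)] = −8π · ξ^3 π^{-3/2} e^{-ξ^2 |x|^2}, where Δ^2 is the bi-Laplacian (Laplacian applied twice) on R^3. -/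
open MeasureTheory Real Filter

noncomputable section

lemma hasDerivAt_erf (t : ℝ) :
    HasDerivAt erf (2 / √π * Real.exp (-t ^ 2)) t := by
  have hc : Continuous fun s : ℝ => Real.exp (-s ^ 2) := by fun_prop
  exact (hc.integral_hasStrictDerivAt 0 t).hasDerivAt.const_mul _

lemma hasDerivAt_exp_neg_sq (ξ r : ℝ) :
    HasDerivAt (fun s => Real.exp (-ξ ^ 2 * s ^ 2))
      (-2 * ξ ^ 2 * r * Real.exp (-ξ ^ 2 * r ^ 2)) r := by
  refine HasDerivAt.congr_deriv ((((hasDerivAt_id r).pow 2).const_mul (-ξ ^ 2)).exp) ?_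
  simp
  ring

lemma hasDerivAt_erf_mul (ξ r : ℝ) :
    HasDerivAt (fun s => erf (ξ * s)) (2 * ξ / √π * Real.exp (-ξ ^ 2 * r ^ 2)) r := by
  refine HasDerivAt.congr_deriv ((hasDerivAt_erf (ξ * r)).comp r ((hasDerivAt_id r).const_mul ξ)) ?_
  rw [show -(ξ * r) ^ 2 = -ξ ^ 2 * r ^ 2 by ring]
  ring

lemma hasFDerivAt_norm {E : Type*} [NormedAddCommGroup E] [InnerProductSpace ℝ E] {x : E}
    (hx : x ≠ 0) : HasFDerivAt (fun y : E => ‖y‖) (‖x‖⁻¹ • innerSL ℝ x) x := by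
  have h := (hasStrictFDerivAt_norm_sq x).hasFDerivAt.sqrt (by simpa using hx)
  simp only [Real.sqrt_sq (norm_nonneg _)] at h
  convert h using 1
  ext v
  simp
  ring

lemma hasFDerivAt_comp_norm {E : Type*} [NormedAddCommGroup E] [InnerProductSpace ℝ E]
    {f : ℝ → ℝ} {f' : ℝ} {x : E} (hx : x ≠ 0) (hf : HasDerivAt f f' ‖x‖) :
    HasFDerivAt (fun y : E => f ‖y‖) (f' • ‖x‖⁻¹ • innerSL ℝ x) x :=
  hf.comp_hasFDerivAt x (hasFDerivAt_norm hx)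

lemma pd_congr {j : Fin 3} {f g : E3 → ℝ} {x : E3} (h : f =ᶠ[nhds x] g) :
    pd j f x = pd j g x := by
  simp only [pd, h.fderiv_eq]

lemma lap_congr {f g : E3 → ℝ} {x : E3} (h : f =ᶠ[nhds x] g) : lap f x = lap g x :=
  Finset.sum_congr rfl fun _ _ =>
    pd_congr (h.eventually_nhds.mono fun _ hy => pd_congr hy)

lemma pd_comp_norm {f : ℝ → ℝ} {f' : ℝ} {x : E3} (hx : x ≠ 0)
    (hf : HasDerivAt f f' ‖x‖) (j : Fin 3) :
    pd j (fun y => f ‖y‖) x = f' / ‖x‖ * x j := by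
  rw [pd, (hasFDerivAt_comp_norm hx hf).fderiv]
  simp [EuclideanSpace.inner_single_right]
  ring

lemma pd_comp_norm_mul_coord {f : ℝ → ℝ} {f' : ℝ} {x : E3} (hx : x ≠ 0)
    (hf : HasDerivAt f f' ‖x‖) (j : Fin 3) :
    pd j (fun y => f ‖y‖ * y j) x = f' / ‖x‖ * x j ^ 2 + f ‖x‖ := by
  have hj : HasFDerivAt (fun y : E3 => y j) (EuclideanSpace.proj j : E3 →L[ℝ] ℝ) x :=
    (EuclideanSpace.proj j : E3 →L[ℝ] ℝ).hasFDerivAt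
  rw [pd, HasFDerivAt.fderiv (f := fun y : E3 => f ‖y‖ * y j) ((hasFDerivAt_comp_norm hx hf).mul hj)]
  simp [EuclideanSpace.inner_single_right]
  ring

lemma lap_comp_norm {f f' f'' : ℝ → ℝ} (hf : ∀ r, 0 < r → HasDerivAt f (f' r) r)
    (hf' : ∀ r, 0 < r → HasDerivAt f' (f'' r) r) {x : E3} (hx : x ≠ 0) :
    lap (fun y => f ‖y‖) x = f'' ‖x‖ + 2 * f' ‖x‖ / ‖x‖ := by
  have hr : 0 < ‖x‖ := norm_pos_iff.2 hx
  have hpd (j : Fin 3) : pd j (fun y => f ‖y‖) =ᶠ[nhds x] fun y => f' ‖y‖ / ‖y‖ * y j :=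
    (eventually_ne_nhds hx).mono fun y hy => pd_comp_norm hy (hf _ (norm_pos_iff.2 hy)) j
  have hq := (hf' _ hr).div (hasDerivAt_id ‖x‖) hr.ne'
  have hsq : ‖x‖ ^ 2 = x 0 ^ 2 + x 1 ^ 2 + x 2 ^ 2 := by
    simp [EuclideanSpace.real_norm_sq_eq, Fin.sum_univ_three]
  have hsum (j : Fin 3) := (pd_congr (hpd j)).trans (pd_comp_norm_mul_coord hx hq j)
  simp only [lap, hsum, Fin.sum_univ_three, id, mul_one, Pi.div_apply]
  rw [show ∀ a b c d e : ℝ, a * b + e + (a * c + e) + (a * d + e) = a * (b + c + d) + 3 * e by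
    intros; ring, ← hsq]
  field_simp
  ring

lemma lap_ewald_splitting {ξ : ℝ} (hξ : 0 < ξ) {x : E3} (hx : x ≠ 0) :
    lap (fun y => ‖y‖ * erf (ξ * ‖y‖) + erf (ξ * ‖y‖) / (2 * ξ ^ 2 * ‖y‖)
        + Real.exp (-ξ ^ 2 * ‖y‖ ^ 2) / (√π * ξ)) x = 2 * erf (ξ * ‖x‖) / ‖x‖ := by
  have hr : 0 < ‖x‖ := norm_pos_iff.2 hx
  have hπ : √π ≠ 0 := (Real.sqrt_pos.2 Real.pi_pos).ne'
  rw [lap_comp_norm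
    (f := fun r => r * erf (ξ * r) + erf (ξ * r) / (2 * ξ ^ 2 * r)
      + Real.exp (-ξ ^ 2 * r ^ 2) / (√π * ξ))
    (f' := fun r => erf (ξ * r) - erf (ξ * r) / (2 * ξ ^ 2 * r ^ 2)
      + Real.exp (-ξ ^ 2 * r ^ 2) / (√π * ξ * r))
    (f'' := fun r => erf (ξ * r) / (ξ ^ 2 * r ^ 3)
      - 2 * Real.exp (-ξ ^ 2 * r ^ 2) / (√π * ξ * r ^ 2)) ?_ ?_ hx]
  · field_simp
    ring
  · intro r hr
    have hE := hasDerivAt_erf_mul ξ r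
    refine HasDerivAt.congr_deriv
      ((((hasDerivAt_id r).mul hE).add
      (hE.div ((hasDerivAt_id r).const_mul (2 * ξ ^ 2)) (by simp [hξ.ne', hr.ne']))).add
      ((hasDerivAt_exp_neg_sq ξ r).div_const (√π * ξ))) ?_
    simp only [id]
    field_simp
    ring
  · intro r hr
    have hE := hasDerivAt_erf_mul ξ r
    refine HasDerivAt.congr_deriv
      ((hE.sub (hE.div (((hasDerivAt_id r).pow 2).const_mul (2 * ξ ^ 2))
      (by simp [hξ.ne', hr.ne']))).add
      ((hasDerivAt_exp_neg_sq ξ r).div ((hasDerivAt_id r).const_mul (√π * ξ))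
        (by simp [hξ.ne', hr.ne', hπ]))) ?_
    simp only [id, Pi.pow_apply]
    field_simp
    ring

lemma lap_erf_div_norm (ξ : ℝ) {x : E3} (hx : x ≠ 0) :
    lap (fun y => 2 * erf (ξ * ‖y‖) / ‖y‖) x
      = -8 * ξ ^ 3 / √π * Real.exp (-ξ ^ 2 * ‖x‖ ^ 2) := by
  have hr : 0 < ‖x‖ := norm_pos_iff.2 hx
  have hπ : √π ≠ 0 := (Real.sqrt_pos.2 Real.pi_pos).ne'
  rw [lap_comp_norm (f := fun r => 2 * erf (ξ * r) / r)
    (f' := fun r => 4 * ξ / √π * Real.exp (-ξ ^ 2 * r ^ 2) / r - 2 * erf (ξ * r) / r ^ 2)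
    (f'' := fun r => 4 * erf (ξ * r) / r ^ 3
      - (8 * ξ ^ 3 + 8 * ξ / r ^ 2) / √π * Real.exp (-ξ ^ 2 * r ^ 2)) ?_ ?_ hx]
  · field_simp
    ring
  · intro r hr
    refine HasDerivAt.congr_deriv
      (((hasDerivAt_erf_mul ξ r).const_mul 2).div (hasDerivAt_id r) hr.ne') ?_
    field_simp
    ring
  · intro r hr
    refine HasDerivAt.congr_deriv
      ((((hasDerivAt_exp_neg_sq ξ r).const_mul (4 * ξ / √π)).div
      (hasDerivAt_id r) hr.ne').sub
      (((hasDerivAt_erf_mul ξ r).const_mul 2).div ((hasDerivAt_id r).pow 2)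
        (by simp [hr.ne']))) ?_
    simp only [id]
    field_simp
    ring

/-- The Ewald splitting function satisfies the biharmonic relation
`Δ² Φ_E(|x|, ξ) = −8π γ_E(x, ξ)`. -/
theorem ewald_splitting_bilaplacian (ξ : ℝ) (hξ : 0 < ξ) (x : E3) (hx : x ≠ 0) :
    lap (lap (fun y => ‖y‖ * erf (ξ * ‖y‖) + erf (ξ * ‖y‖) / (2 * ξ ^ 2 * ‖y‖)
        + Real.exp (-ξ ^ 2 * ‖y‖ ^ 2) / (Real.sqrt π * ξ))) x
      = -(8 * π) * (ξ ^ 3 * π ^ (-(3 : ℝ) / 2) * Real.exp (-ξ ^ 2 * ‖x‖ ^ 2)) := by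
  have hlap := lap_congr ((eventually_ne_nhds hx).mono fun y hy => lap_ewald_splitting hξ hy)
  have hπ : π ^ (-(3 : ℝ) / 2) = (π * √π)⁻¹ := by
    rw [show (-(3 : ℝ) / 2) = -(1 + 1 / 2) by norm_num, Real.rpow_neg Real.pi_pos.le,
      Real.rpow_add Real.pi_pos, Real.rpow_one, Real.sqrt_eq_rpow]
  have hπ0 : √π ≠ 0 := (Real.sqrt_pos.2 Real.pi_pos).ne'
  rw [hlap, lap_erf_div_norm ξ hx, hπ]
  field_simp
end
end

section
/- For every ξ > 0 and all indices j, l in {1,2,3}, the self-interaction limit of the Hasimoto decomposition of the stokeslet satisfies lim_{x → 0, x ≠ 0} [ S^R_{jl}(x, ξ) − S_{jl}(x) ] = −(4ξ/√π) δ_{jl}, where S_{jl}(x) = δ_{jl}/|x| + x_j x_l/|x|^3 is the stokeslet. -/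
open MeasureTheory Real Filter

noncomputable section

theorem erf_zero : erf 0 = 0 := by simp [erf]

theorem hasDerivAt_erf_zero : HasDerivAt erf (2 / √π) 0 := by
  have hc : Continuous fun s : ℝ => Real.exp (-s ^ 2) := by fun_prop
  have h := (hc.integral_hasStrictDerivAt 0 0).hasDerivAt.const_mul (2 / √π)
  have hslope : 2 / √π * Real.exp (-0 ^ 2) = 2 / √π := by simp
  rwa [hslope] at h

/-- `erf (ξ r) / r` tends to its limiting slope as `r = ‖x‖ → 0`. -/
theorem tendsto_erf_mul_norm_div_norm {E : Type*} [NormedAddCommGroup E] (ξ : ℝ) :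
    Tendsto (fun x : E => erf (ξ * ‖x‖) / ‖x‖) (nhdsWithin 0 {0}ᶜ)
      (nhds (2 * ξ / √π)) := by
  have hd : HasDerivAt (fun r : ℝ => erf (ξ * r)) (2 / √π * ξ) 0 := by
    have h : HasDerivAt erf (2 / √π) (ξ * 0) := by simpa using hasDerivAt_erf_zero
    have hcomp := h.comp (0 : ℝ) ((hasDerivAt_id (0 : ℝ)).const_mul ξ)
    rwa [mul_one] at hcomp
  have hn : Tendsto (fun x : E => ‖x‖) (nhdsWithin 0 {0}ᶜ) (nhdsWithin 0 {0}ᶜ) :=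
    tendsto_norm_nhdsNE_zero.mono_right (nhdsWithin_mono _ fun r hr => ne_of_gt hr)
  have h := (hasDerivAt_iff_tendsto_slope.mp hd).comp hn
  rw [mul_div_right_comm]
  exact h.congr fun x => by simp [slope_def_field, erf_zero]

theorem abs_kron_add_mul_le (j l : Fin 3) (x : E3) :
    |kron j l + (x j / ‖x‖) * (x l / ‖x‖)| ≤ 2 := by
  have hcoord (i : Fin 3) : |x i / ‖x‖| ≤ 1 := by
    rw [abs_div, abs_norm]
    exact div_le_one_of_le₀ (PiLp.norm_apply_le x i) (norm_nonneg x)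
  have hkron : |kron j l| ≤ 1 := by
    unfold kron
    split_ifs <;> simp
  calc |kron j l + (x j / ‖x‖) * (x l / ‖x‖)|
      ≤ |kron j l| + |x j / ‖x‖| * |x l / ‖x‖| := by
        rw [← abs_mul]
        exact abs_add_le _ _
    _ ≤ 1 + 1 * 1 := by gcongr <;> apply hcoord
    _ = 2 := by norm_num

/-- Self-interaction limit of the Hasimoto decomposition of the stokeslet:
`lim_{x → 0, x ≠ 0} [S^R_{jl}(x, ξ) − S_{jl}(x)] = −(4ξ/√π) δ_{jl}`. -/
theorem stokeslet_self_interaction_limit (ξ : ℝ) (hξ : 0 < ξ) (j l : Fin 3) :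
    Tendsto (fun x : E3 =>
        (2 * (ξ * Real.exp (-ξ ^ 2 * ‖x‖ ^ 2) / Real.sqrt π
              + erfc (ξ * ‖x‖) / (2 * ‖x‖))
            * (kron j l + (x j / ‖x‖) * (x l / ‖x‖))
          - (4 * ξ / Real.sqrt π) * Real.exp (-ξ ^ 2 * ‖x‖ ^ 2) * kron j l)
        - (kron j l / ‖x‖ + x j * x l / ‖x‖ ^ 3))
      (nhdsWithin 0 {0}ᶜ)
      (nhds (-(4 * ξ / Real.sqrt π) * kron j l)) := by
  have hexp : Tendsto (fun x : E3 => Real.exp (-ξ ^ 2 * ‖x‖ ^ 2)) (nhdsWithin 0 {0}ᶜ)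
      (nhds 1) := by
    have hc : Continuous fun x : E3 => Real.exp (-ξ ^ 2 * ‖x‖ ^ 2) := by fun_prop
    simpa using (hc.tendsto 0).mono_left nhdsWithin_le_nhds
  have hradial : Tendsto (fun x : E3 => 2 * ξ / √π * Real.exp (-ξ ^ 2 * ‖x‖ ^ 2)
      - erf (ξ * ‖x‖) / ‖x‖) (nhdsWithin 0 {0}ᶜ) (nhds 0) := by
    simpa using (hexp.const_mul (2 * ξ / √π)).sub (tendsto_erf_mul_norm_div_norm ξ)
  have hangular := hradial.zero_mul_isBoundedUnder_le
    (g := fun x : E3 => kron j l + (x j / ‖x‖) * (x l / ‖x‖))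
    (isBoundedUnder_of ⟨2, abs_kron_add_mul_le j l⟩)
  have hlim := hangular.sub ((hexp.const_mul (4 * ξ / √π)).mul_const (kron j l))
  rw [mul_one, zero_sub, ← neg_mul] at hlim
  refine hlim.congr' ?_
  filter_upwards [self_mem_nhdsWithin] with x hx
  have hr : ‖x‖ ≠ 0 := norm_ne_zero_iff.mpr hx
  have hpi : √π ≠ 0 := (Real.sqrt_pos.mpr Real.pi_pos).ne'
  unfold erfc
  field_simp
  ring
end
end
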